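/- Let z ∈ ℂ be algebraic over ℚ and suppose that the subring ℤ[z] of ℂ is discrete with respect to the topology induced by ℂ. Then ℤ[z] is an order in the number field ℚ(z); in particular z is integral over ℤ and [ℚ(z) : ℚ] ≤ 2. -/

import Mathlib

/-- `R` is an order in the subfield `F` of `ℂ`: `R ⊆ F`, `R` is finitely generated
as a `ℤ`-module (equivalently, as an additive group), and `R` contains a `ℚ`-basis
of `F`, i.e. the `ℚ`-span of `R` is `F`. -/
def IsOrderIn (R : Subring ℂ) (F : Subfield ℂ) : Prop :=
  (R : Set ℂ) ⊆ (F : Set ℂ) ∧ R.toAddSubgroup.FG ∧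
    (Submodule.span ℚ (R : Set ℂ) : Set ℂ) = (F : Set ℂ)

/-- The `ℚ`-span of `ℤ[z]` is `ℚ(z)` when `z` is algebraic. -/
theorem span_rat_subring_closure_singleton (z : ℂ) (halg : IsAlgebraic ℚ z) :
    (Submodule.span ℚ (Subring.closure ({z} : Set ℂ) : Set ℂ) : Set ℂ) =
      (Subfield.closure ({z} : Set ℂ) : Set ℂ) := by
  apply Set.Subset.antisymm
  · intro x hx
    induction hx using Submodule.span_induction with
    | mem x hx =>
      exact Subfield.subring_closure_le _ hx
    | zero => exact zero_mem (Subfield.closure {z})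
    | add x y _ _ hx hy => exact add_mem (S := Subfield ℂ) hx hy
    | smul a x _ hx =>
      rw [Rat.smul_def]
      exact mul_mem (S := Subfield ℂ) (SubfieldClass.ratCast_mem _ a) hx
  · have hle : Subfield.closure {z} ≤ (IntermediateField.adjoin ℚ {z}).toSubfield :=
      Subfield.closure_le.mpr (IntermediateField.subset_adjoin ℚ {z})
    intro x hx
    have hx' : x ∈ (IntermediateField.adjoin ℚ {z}).toSubalgebra := hle hx
    rw [IntermediateField.adjoin_simple_toSubalgebra_of_isAlgebraic halg,
      ← Subalgebra.mem_toSubmodule, Algebra.adjoin_eq_span] at hx'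
    have hmon : Submonoid.closure {z} ≤ (Subring.closure ({z} : Set ℂ)).toSubmonoid :=
      Submonoid.closure_le.mpr Subring.subset_closure
    exact Submodule.span_mono hmon hx'

/-- The `ℚ`-span of a discrete additive subgroup of a real vector space `E` has dimension at most
`dim E`. -/
theorem finrank_rat_span_le_of_discrete {E : Type*} [NormedAddCommGroup E] [NormedSpace ℝ E]
    [FiniteDimensional ℝ E] [Module ℚ E] (L : Submodule ℤ E) [DiscreteTopology L] :
    Module.Finite ℚ (Submodule.span ℚ (L : Set E)) ∧
      Module.finrank ℚ (Submodule.span ℚ (L : Set E)) ≤ Module.finrank ℝ E := by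
  let b := Module.finBasis ℤ L
  have hspan : Submodule.span ℚ (L : Set E) =
      Submodule.span ℚ (Set.range fun i => (b i : E)) := by
    have hL : Submodule.span ℤ (Set.range fun i => (b i : E)) = L := by
      have h := congrArg (Submodule.map L.subtype) b.span_eq
      rwa [Submodule.map_span, ← Set.range_comp, Submodule.map_subtype_top] at h
    conv_lhs => rw [← hL]
    exact Submodule.span_span_of_tower ℤ ℚ _
  have hrank : Module.finrank ℤ L ≤ Module.finrank ℝ E := by
    have hdisc : DiscreteTopology (Submodule.span ℤ (L : Set E)) := by
      rwa [Submodule.span_eq]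
    have h := Real.finrank_eq_int_finrank_of_discrete hdisc
    rw [Set.finrank, Set.finrank, Submodule.span_eq] at h
    exact h ▸ Submodule.finrank_le _
  rw [hspan]
  refine ⟨Module.Finite.span_of_finite ℚ (Set.finite_range _), ?_⟩
  refine (finrank_range_le_card _).trans ?_
  rwa [Fintype.card_fin]

theorem stmt14 (z : ℂ) (halg : IsAlgebraic ℚ z)
    (hdisc : DiscreteTopology ↥(Subring.closure ({z} : Set ℂ))) :
    IsOrderIn (Subring.closure ({z} : Set ℂ)) (Subfield.closure ({z} : Set ℂ)) ∧
      IsIntegral ℤ z ∧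
      Module.finrank ℚ ↥(Subfield.closure ({z} : Set ℂ)) ≤ 2 := by
  let R := Subring.closure ({z} : Set ℂ)
  let L : Submodule ℤ ℂ := R.toAddSubgroup.toIntSubmodule
  have hL : DiscreteTopology L := hdisc
  have hfg : L.FG := Module.Finite.iff_fg.mp inferInstance
  have hspan := span_rat_subring_closure_singleton z halg
  obtain ⟨hfin, hrank⟩ := finrank_rat_span_le_of_discrete L
  refine ⟨⟨Subfield.subring_closure_le _, ?_, hspan⟩, ?_, ?_⟩
  · exact (Submodule.fg_iff_addSubgroup_fg L).mp hfg
  · exact IsIntegral.of_mem_of_fg (subalgebraOfSubring R) hfg z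
      (Subring.subset_closure (Set.mem_singleton z))
  · let f : Subfield.closure ({z} : Set ℂ) →+ Submodule.span ℚ (L : Set ℂ) :=
      { toFun x := ⟨x, hspan.ge x.2⟩
        map_zero' := rfl
        map_add' _ _ := rfl }
    have hf : Function.Injective f.toRatLinearMap := by
      intro x y h
      have hval := congrArg Subtype.val h
      exact Subtype.ext hval
    exact (LinearMap.finrank_le_finrank_of_injective hf).trans
      (hrank.trans_eq Complex.finrank_real_complex)
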